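/- Let G be a group, δ₁, δ₂ : G → ZMod 2 group homomorphisms, and for i = 1, 2 let πᵢ : Hᵢ → G be a surjective group homomorphism and ιᵢ : Circle → Hᵢ an injective group homomorphism whose image is central in Hᵢ and equals ker πᵢ. Let P = {(x, y) ∈ H₁ × H₂ : π₁(x) = π₂(y)} with multiplication (x₁, y₁) * (x₂, y₂) := (ι₁((-1)^{(δ₂(π₁ x₁) · δ₁(π₁ x₂)).val}) x₁ x₂, y₁ y₂). Then: (a) this multiplication makes P a group with identity (1,1); (b) the antidiagonal D = {(ι₁(μ), ι₂(μ⁻¹)) : μ ∈ Circle} is a central subgroup of P; (c) the quotient P/D, together with the map [(x,y)] ↦ π₁(x) and the map λ ↦ [(ι₁(λ), 1)], is again a central extension of G by Circle (the map to G is a surjective homomorphism whose kernel is central and is the injective image of Circle under λ ↦ [(ι₁(λ), 1)]). -/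

import Mathlib

/-- The element `-1` of the circle group. -/
noncomputable def Circle.negOne : Circle :=
  ⟨-1, by show -1 ∈ Submonoid.unitSphere ℂ; simp [Submonoid.unitSphere]⟩

/-- The underlying set of the fiber product of two groups over `G`, used for sums of
(graded) central extensions of `G`. -/
abbrev FiberProd {G H₁ H₂ : Type*} [Group G] [Group H₁] [Group H₂]
    (π₁ : H₁ →* G) (π₂ : H₂ →* G) : Type _ :=
  {p : H₁ × H₂ // π₁ p.1 = π₂ p.2}


theorem Circle.negOne_sq : Circle.negOne ^ 2 = 1 := by
  apply Circle.ext
  rw [Circle.coe_pow]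
  change (-1 : ℂ) ^ 2 = 1
  norm_num

theorem Circle.negOne_pow_val_add (a b : ZMod 2) :
    Circle.negOne ^ (a + b).val = Circle.negOne ^ a.val * Circle.negOne ^ b.val := by
  rw [← pow_add, ZMod.val_add, ← pow_eq_pow_mod _ Circle.negOne_sq]

/-- The fiber product group, twisted by a bimultiplicative central pairing. -/
@[reducible] def twistedGroup {G H₁ H₂ : Type*} [Group G] [Group H₁] [Group H₂]
    (π₁ : H₁ →* G) (π₂ : H₂ →* G) (s : G → G → H₁)
    (hl : ∀ a b c, s (a * b) c = s a c * s b c)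
    (hr : ∀ a b c, s a (b * c) = s a b * s a c)
    (hc : ∀ a b x, x * s a b = s a b * x)
    (hp : ∀ a b, π₁ (s a b) = 1) : Group (FiberProd π₁ π₂) :=
  have h1 : ∀ a, s 1 a = 1 := fun a => by
    have := hl 1 1 a
    simpa using this
  have h2 : ∀ a, s a 1 = 1 := fun a => by
    have := hr a 1 1
    simpa using this
  letI : Mul (FiberProd π₁ π₂) := ⟨fun p q =>
    ⟨(s (π₁ p.1.1) (π₁ q.1.1) * (p.1.1 * q.1.1), p.1.2 * q.1.2), by
      simp [hp, p.2, q.2]⟩⟩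
  letI : One (FiberProd π₁ π₂) := ⟨⟨(1, 1), by simp⟩⟩
  letI : Inv (FiberProd π₁ π₂) := ⟨fun p =>
    ⟨(s (π₁ p.1.1) (π₁ p.1.1) * p.1.1⁻¹, p.1.2⁻¹), by simp [hp, p.2]⟩⟩
  Group.ofLeftAxioms
    (by
      rintro ⟨⟨x, x'⟩, hx⟩ ⟨⟨y, y'⟩, hy⟩ ⟨⟨z, z'⟩, hz⟩
      apply Subtype.ext
      refine Prod.ext ?_ (mul_assoc _ _ _)
      change s (π₁ (s (π₁ x) (π₁ y) * (x * y))) (π₁ z) * (s (π₁ x) (π₁ y) * (x * y) * z) =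
        s (π₁ x) (π₁ (s (π₁ y) (π₁ z) * (y * z))) * (x * (s (π₁ y) (π₁ z) * (y * z)))
      simp only [map_mul, hp, one_mul, hl, hr]
      have e : x * (s (π₁ y) (π₁ z) * (y * z)) = s (π₁ y) (π₁ z) * (x * (y * z)) := by
        rw [← mul_assoc, hc, mul_assoc]
      have e' := hc (π₁ x) (π₁ y) (s (π₁ x) (π₁ z) * s (π₁ y) (π₁ z))
      rw [e]
      calc _ = s (π₁ x) (π₁ z) * s (π₁ y) (π₁ z) * s (π₁ x) (π₁ y) * (x * (y * z)) := by
            simp only [mul_assoc]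
        _ = _ := by
            rw [e']
            simp only [mul_assoc])
    (by
      rintro ⟨⟨x, x'⟩, hx⟩
      apply Subtype.ext
      refine Prod.ext ?_ (one_mul _)
      change s (π₁ 1) (π₁ x) * (1 * x) = x
      simp [h1])
    (by
      rintro ⟨⟨x, x'⟩, hx⟩
      apply Subtype.ext
      refine Prod.ext ?_ (inv_mul_cancel _)
      change s (π₁ (s (π₁ x) (π₁ x) * x⁻¹)) (π₁ x) * (s (π₁ x) (π₁ x) * x⁻¹ * x) = 1
      simp only [map_mul, hp, one_mul, map_inv, inv_mul_cancel_right, ← hl, inv_mul_cancel, h1])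

/-- Given two graded central extensions `(H₁, δ₁)` and `(H₂, δ₂)` of `G` by
`Circle`, the fiber product `P` with the Koszul-sign-twisted multiplication
`(x₁,y₁)(x₂,y₂) = (ι₁((-1)^{δ₂(π₁x₁)·δ₁(π₁x₂)}) x₁x₂, y₁y₂)` is a group with identity `(1,1)`;
the antidiagonal circle `D = {(ι₁ μ, ι₂ μ⁻¹)}` is a central subgroup; and the quotient `P ⧸ D`
is again a central extension of `G` by `Circle`. -/
theorem sum_of_graded_central_extensions_is_central_extension
    (G H₁ H₂ : Type*) [Group G] [Group H₁] [Group H₂]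
    (δ₁ δ₂ : G → ZMod 2)
    (hδ₁ : ∀ g h : G, δ₁ (g * h) = δ₁ g + δ₁ h)
    (hδ₂ : ∀ g h : G, δ₂ (g * h) = δ₂ g + δ₂ h)
    (π₁ : H₁ →* G) (hπ₁ : Function.Surjective π₁)
    (ι₁ : Circle →* H₁) (hι₁ : Function.Injective ι₁)
    (hcent₁ : ι₁.range ≤ Subgroup.center H₁) (hker₁ : ι₁.range = π₁.ker)
    (π₂ : H₂ →* G) (hπ₂ : Function.Surjective π₂)
    (ι₂ : Circle →* H₂) (hι₂ : Function.Injective ι₂)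
    (hcent₂ : ι₂.range ≤ Subgroup.center H₂) (hker₂ : ι₂.range = π₂.ker) :
    ∃ _ : Group (FiberProd π₁ π₂),
      -- (a) the multiplication is the sign-twisted one and the identity is `(1, 1)`
      (∀ p q : FiberProd π₁ π₂,
        (p * q).1 =
          (ι₁ (Circle.negOne ^ (δ₂ (π₁ p.1.1) * δ₁ (π₁ q.1.1)).val) * (p.1.1 * q.1.1),
           p.1.2 * q.1.2)) ∧
      ((1 : FiberProd π₁ π₂)).1 = ((1 : H₁), (1 : H₂)) ∧
      -- (b) the antidiagonal circle is a central subgroup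
      ∃ D : Subgroup (FiberProd π₁ π₂),
        (∀ p : FiberProd π₁ π₂, p ∈ D ↔ ∃ μ : Circle, p.1 = (ι₁ μ, ι₂ μ⁻¹)) ∧
        D ≤ Subgroup.center (FiberProd π₁ π₂) ∧
        -- (c) the quotient is again a central extension of `G` by `Circle`
        ∃ _ : D.Normal,
          ∃ (q : FiberProd π₁ π₂ ⧸ D →* G) (e : Circle →* FiberProd π₁ π₂ ⧸ D),
            (∀ p : FiberProd π₁ π₂, q (QuotientGroup.mk p) = π₁ p.1.1) ∧
            (∀ (l : Circle) (p : FiberProd π₁ π₂), p.1 = (ι₁ l, 1) →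
              e l = QuotientGroup.mk p) ∧
            Function.Surjective q ∧ Function.Injective e ∧
            e.range ≤ Subgroup.center (FiberProd π₁ π₂ ⧸ D) ∧
            e.range = q.ker := by
  have hc₁ : ∀ (l : Circle) (x : H₁), x * ι₁ l = ι₁ l * x := fun l x =>
    Subgroup.mem_center_iff.1 (hcent₁ ⟨l, rfl⟩) x
  have hc₂ : ∀ (l : Circle) (x : H₂), x * ι₂ l = ι₂ l * x := fun l x =>
    Subgroup.mem_center_iff.1 (hcent₂ ⟨l, rfl⟩) x
  have hp₁ : ∀ l : Circle, π₁ (ι₁ l) = 1 := fun l => by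
    have : ι₁ l ∈ π₁.ker := hker₁ ▸ ⟨l, rfl⟩
    exact this
  have hp₂ : ∀ l : Circle, π₂ (ι₂ l) = 1 := fun l => by
    have : ι₂ l ∈ π₂.ker := hker₂ ▸ ⟨l, rfl⟩
    exact this
  have hk₁ : ∀ x, π₁ x = 1 → ∃ l, ι₁ l = x := fun x hx => by
    have : x ∈ ι₁.range := hker₁ ▸ hx
    exact this
  have hk₂ : ∀ x, π₂ x = 1 → ∃ l, ι₂ l = x := fun x hx => by
    have : x ∈ ι₂.range := hker₂ ▸ hx
    exact this
  have d₁ : δ₁ 1 = 0 := by simpa using hδ₁ 1 1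
  have d₂ : δ₂ 1 = 0 := by simpa using hδ₂ 1 1
  let grp : Group (FiberProd π₁ π₂) := twistedGroup π₁ π₂
    (fun a b => ι₁ (Circle.negOne ^ (δ₂ a * δ₁ b).val))
    (fun a b c => by
      rw [hδ₂, add_mul, Circle.negOne_pow_val_add, map_mul])
    (fun a b c => by
      rw [hδ₁, mul_add, Circle.negOne_pow_val_add, map_mul])
    (fun a b x => hc₁ _ x) (fun a b => hp₁ _)
  have hmul : ∀ p q : FiberProd π₁ π₂,
        (p * q).1 =
          (ι₁ (Circle.negOne ^ (δ₂ (π₁ p.1.1) * δ₁ (π₁ q.1.1)).val) * (p.1.1 * q.1.1),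
           p.1.2 * q.1.2) := fun p q => rfl
  have hone : ((1 : FiberProd π₁ π₂)).1 = ((1 : H₁), (1 : H₂)) := rfl
  clear_value grp
  -- multiplication by elements over `1` is untwisted
  have hmul_l : ∀ p q : FiberProd π₁ π₂, π₁ p.1.1 = 1 →
      (p * q).1 = (p.1.1 * q.1.1, p.1.2 * q.1.2) := fun p q h => by
    rw [hmul, h, d₂]; simp
  have hmul_r : ∀ p q : FiberProd π₁ π₂, π₁ q.1.1 = 1 →
      (p * q).1 = (p.1.1 * q.1.1, p.1.2 * q.1.2) := fun p q h => by
    rw [hmul, h, d₁]; simp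
  let T : Circle × Circle →* FiberProd π₁ π₂ :=
    { toFun := fun a => ⟨(ι₁ a.1, ι₂ a.2), by simp [hp₁, hp₂]⟩
      map_one' := Subtype.ext (by rw [hone]; simp)
      map_mul' := fun a b => Subtype.ext (by rw [hmul_l _ _ (hp₁ _)]; simp) }
  have hT : ∀ a, (T a).1 = (ι₁ a.1, ι₂ a.2) := fun a => rfl
  have hTc : ∀ a, T a ∈ Subgroup.center (FiberProd π₁ π₂) := fun a => by
    rw [Subgroup.mem_center_iff]
    intro p
    apply Subtype.ext
    rw [hmul_r p (T a) (hp₁ _), hmul_l (T a) p (hp₁ _)]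
    simp [hT, hc₁, hc₂]
  let A : Circle →* Circle × Circle := (MonoidHom.id Circle).prod (invMonoidHom)
  let D := (T.comp A).range
  have hD : ∀ p : FiberProd π₁ π₂, p ∈ D ↔ ∃ μ : Circle, p.1 = (ι₁ μ, ι₂ μ⁻¹) := fun p =>
    ⟨fun ⟨μ, h⟩ => ⟨μ, h ▸ rfl⟩, fun ⟨μ, h⟩ => ⟨μ, Subtype.ext h.symm⟩⟩
  have hDc : D ≤ Subgroup.center (FiberProd π₁ π₂) := by
    rintro _ ⟨μ, rfl⟩
    exact hTc _
  have hN : D.Normal := ⟨fun n hn g => by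
    rw [Subgroup.mem_center_iff.1 (hDc hn) g]; simpa using hn⟩
  let Q : FiberProd π₁ π₂ →* G :=
    { toFun := fun p => π₁ p.1.1
      map_one' := by rw [hone]; simp
      map_mul' := fun a b => by rw [hmul]; simp [hp₁] }
  have hQ : ∀ p, Q p = π₁ p.1.1 := fun p => rfl
  have hDQ : D ≤ Q.ker := by
    rintro _ ⟨μ, rfl⟩
    exact hp₁ _
  let I : Circle →* Circle × Circle := MonoidHom.inl Circle Circle
  have hI : ∀ l, (T (I l)).1 = (ι₁ l, 1) := fun l => by rw [hT]; simp [I]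
  refine ⟨grp, hmul, hone, D, hD, hDc, hN, QuotientGroup.lift D Q hDQ,
    (QuotientGroup.mk' D).comp (T.comp I), fun p => rfl, ?_, ?_, ?_, ?_, ?_⟩
  · intro l p h
    have : p = T (I l) := Subtype.ext (h.trans (hI l).symm)
    rw [this]; rfl
  · intro g
    obtain ⟨x, hx⟩ := hπ₁ g
    obtain ⟨y, hy⟩ := hπ₂ g
    exact ⟨QuotientGroup.mk ⟨(x, y), hx.trans hy.symm⟩, hx⟩
  · rw [injective_iff_map_eq_one]
    intro l h
    have h' : T (I l) ∈ D := (QuotientGroup.eq_one_iff _).1 h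
    obtain ⟨μ, hμ⟩ := (hD _).1 h'
    rw [hI, Prod.mk.injEq] at hμ
    have e2 : μ⁻¹ = 1 := hι₂ (by rw [← hμ.2, map_one])
    rw [hι₁ hμ.1]
    simpa using e2
  · rintro _ ⟨l, rfl⟩
    rw [Subgroup.mem_center_iff]
    intro z
    obtain ⟨p, rfl⟩ := QuotientGroup.mk'_surjective D z
    have := Subgroup.mem_center_iff.1 (hTc (I l)) p
    simp only [MonoidHom.comp_apply, ← map_mul (QuotientGroup.mk' D), this]
  · apply le_antisymm
    · rintro _ ⟨l, rfl⟩
      exact hp₁ _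
    · intro z hz
      obtain ⟨p, rfl⟩ := QuotientGroup.mk'_surjective D z
      have h1 : π₁ p.1.1 = 1 := hz
      obtain ⟨a, ha⟩ := hk₁ _ h1
      obtain ⟨b, hb⟩ := hk₂ _ (p.2.symm.trans h1)
      have hpT : p = T (a, b) := Subtype.ext (by rw [hT, ha, hb])
      refine ⟨a * b, ?_⟩
      rw [hpT]
      refine QuotientGroup.eq.2 ?_
      rw [MonoidHom.comp_apply, ← map_inv, ← map_mul]
      refine ⟨b⁻¹, ?_⟩
      rw [MonoidHom.comp_apply]
      congr 1
      ext1 <;> simp [A, I]
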